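/- arXiv:0706.2902 — 6 statements merged into one kernel-verified Lean document; each statement's English description precedes it below -/
import Mathlib

section
/- Let N ≥ 3 be odd. Then there exists an invertible real N×N matrix T such that T⁻¹ Γ T = diag(Λ_{N−1}, 0), where Λ_{N−1} = diag(−I_{(N−1)/2}, J_{(N−1)/2}) and the final diagonal block is the 1×1 zero block. In particular, Γ is similar to diag(Λ_{N−1}, 0). -/
open Matrix

/-- The outer coupling matrix `Γ` (1-indexed entries `γ_{ij}`: `γ_{ii} = 0`; for `i > j`,
`γ_{ij} = −1` if `j ≤ i−2` and `j` is odd, `γ_{ij} = 1` otherwise; `γ_{ij} = 1` for `i < j`).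
Here indices are 0-based. -/
def Gam (N : ℕ) : Matrix (Fin N) (Fin N) ℝ :=
  Matrix.of fun i j =>
    if i = j then 0
    else if j.1 + 2 ≤ i.1 ∧ j.1 % 2 = 0 then -1
    else 1

/-- `Λ_M = diag(−I_{M/2}, J_{M/2})`, where `J_m` is the `m × m` upper bidiagonal matrix with
diagonal entries `1` and superdiagonal entries `2`. -/
def LambdaMat (M : ℕ) : Matrix (Fin M) (Fin M) ℝ :=
  Matrix.of fun i j =>
    if i.1 < M / 2 then (if i = j then -1 else 0)
    else if j.1 < M / 2 then 0
    else if i = j then 1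
    else if j.1 = i.1 + 1 then 2
    else 0

/-- `diag(Λ_{N−1}, 0)`: the `N × N` matrix with top-left block `Λ_{N−1}` and the final
`1 × 1` diagonal block equal to zero. -/
def LambdaOdd (N : ℕ) : Matrix (Fin N) (Fin N) ℝ :=
  Matrix.of fun i j =>
    if hi : i.1 < N - 1 then
      if hj : j.1 < N - 1 then LambdaMat (N - 1) ⟨i.1, hi⟩ ⟨j.1, hj⟩ else 0
    else 0

/-- Coefficients of the Jordan basis: `(-1) ^ (l + k)` times the binomial coefficient `l` over
`k`. -/
def jordanCoeff : ℕ → ℕ → ℝ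
  | 0, 0 => 1
  | 0, _ + 1 => 0
  | l + 1, 0 => -jordanCoeff l 0
  | l + 1, k + 1 => jordanCoeff l k - jordanCoeff l (k + 1)

theorem jordanCoeff_eq_zero : ∀ {l k : ℕ}, l < k → jordanCoeff l k = 0
  | 0, _ + 1, _ => by simp [jordanCoeff]
  | l + 1, k + 1, h => by
    rw [jordanCoeff, jordanCoeff_eq_zero (by omega), jordanCoeff_eq_zero (by omega), sub_zero]

theorem jordanCoeff_self : ∀ l : ℕ, jordanCoeff l l = 1
  | 0 => by simp [jordanCoeff]
  | l + 1 => by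
    rw [jordanCoeff, jordanCoeff_self l, jordanCoeff_eq_zero (Nat.lt_succ_self l), sub_zero]

/-- A telescoping sum over the indices `k ≥ i`. -/
theorem sum_tail_telescope (m : ℕ) (i : Fin m) (g : ℕ → ℝ) :
    ∑ k : Fin m, (if k < i then 0 else g k - g (k + 1)) = g i - g m := by
  have key : ∀ n, i.1 ≤ n →
      ∑ k ∈ Finset.range n, (if k < i.1 then 0 else g k - g (k + 1)) = g i - g n := by
    intro n hn
    induction n, hn using Nat.le_induction with
    | base =>
      rw [sub_self]
      exact Finset.sum_eq_zero fun k hk => if_pos (Finset.mem_range.1 hk)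
    | succ n hn ih =>
      rw [Finset.sum_range_succ, ih, if_neg (by omega)]
      ring
  rw [← key m i.2.le, ← Fin.sum_univ_eq_sum_range
    (fun k => if k < i.1 then 0 else g k - g (k + 1))]
  rfl

/-- Sum of the two consecutive coefficient vectors `l` and `l - 1` (only one if `l = 0`). -/
def jordanCoeffPair (l k : ℕ) : ℝ :=
  jordanCoeff l k + if l = 0 then 0 else jordanCoeff (l - 1) k

theorem jordanCoeffPair_sub_succ (l k : ℕ) :
    jordanCoeffPair l k - jordanCoeffPair l (k + 1) = jordanCoeff l k := by
  cases l <;> simp [jordanCoeffPair, jordanCoeff]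

theorem jordanCoeffPair_eq_zero {l k : ℕ} (h : l < k) : jordanCoeffPair l k = 0 := by
  rw [jordanCoeffPair, jordanCoeff_eq_zero h, jordanCoeff_eq_zero (by omega), ite_self, add_zero]

theorem sum_tail_jordanCoeff {m : ℕ} (i l : Fin m) :
    ∑ k : Fin m, (if k < i then 0 else jordanCoeff l k) = jordanCoeffPair l i := by
  have h := sum_tail_telescope m i (jordanCoeffPair l)
  simpa only [jordanCoeffPair_sub_succ, jordanCoeffPair_eq_zero l.2, sub_zero] using h

theorem two_mul_sum_tail_neg_one_pow {m : ℕ} (i : Fin m) :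
    2 * ∑ k : Fin m, (if k < i then 0 else (-1 : ℝ) ^ (m + k.1)) + 1 = (-1) ^ (m + i.1) := by
  have h := sum_tail_telescope m i (fun k => (-1 : ℝ) ^ (m + k))
  have hm : (-1 : ℝ) ^ (m + m) = 1 := Even.neg_one_pow ⟨m, rfl⟩
  rw [hm] at h
  rw [← eq_sub_iff_add_eq, ← h, Finset.mul_sum]
  refine Finset.sum_congr rfl fun k _ => ?_
  split_ifs <;> ring

/-- Odd positions, even positions other than the last, and the last position. -/
abbrev Idx (m : ℕ) : Type := Fin m ⊕ Fin m ⊕ Unit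

/-- `Γ` with its indices sorted into odd ones, even ones, and the last one. -/
def sortedGam (m : ℕ) : Matrix (Idx m) (Idx m) ℝ
  | .inl i, .inl j => if i = j then 0 else 1
  | .inl i, .inr (.inl j) => if j < i then -1 else 1
  | .inl _, .inr (.inr _) => 1
  | .inr (.inl _), .inl _ => 1
  | .inr (.inl i), .inr (.inl j) => if i = j then 0 else if j < i then -1 else 1
  | .inr (.inl _), .inr (.inr _) => 1
  | .inr (.inr _), .inl _ => 1
  | .inr (.inr _), .inr (.inl _) => -1
  | .inr (.inr _), .inr (.inr _) => 0

/-- The three diagonal blocks `-I`, `J` and `0`. -/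
def sortedLambda (m : ℕ) : Matrix (Idx m) (Idx m) ℝ
  | .inl i, .inl j => if i = j then -1 else 0
  | .inr (.inl i), .inr (.inl j) => if i = j then 1 else if j.1 = i.1 + 1 then 2 else 0
  | _, _ => 0

/-- The columns are eigenvectors for `-1`, a Jordan chain for `1`, and a kernel vector. -/
def sortedBasis (m : ℕ) : Matrix (Idx m) (Idx m) ℝ
  | .inl i, .inl j => if i = j then 1 else 0
  | .inl i, .inr (.inl j) => jordanCoeff j i
  | .inl i, .inr (.inr _) => (-1) ^ (m + i.1)
  | .inr (.inl _), .inl _ => 0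
  | .inr (.inl i), .inr (.inl j) => jordanCoeff j i
  | .inr (.inl i), .inr (.inr _) => (-1) ^ (m + i.1)
  | .inr (.inr _), .inl _ => -1
  | .inr (.inr _), .inr (.inl _) => 0
  | .inr (.inr _), .inr (.inr _) => 1

theorem sum_ite_jordanCoeff_pred {m : ℕ} (i l : Fin m) :
    ∑ k : Fin m, jordanCoeff k i * (if k = l then 1 else if l.1 = k.1 + 1 then 2 else 0) =
      2 * jordanCoeffPair l i - jordanCoeff l i := by
  have hsplit : ∀ k : Fin m,
      jordanCoeff k i * (if k = l then 1 else if l.1 = k.1 + 1 then 2 else 0) =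
        (if k = l then jordanCoeff k i else 0) +
          (if l.1 = k.1 + 1 then 2 * jordanCoeff k i else 0) := by
    intro k
    rcases eq_or_ne k l with rfl | h
    · simp
    · simp only [h, if_false]
      split_ifs <;> ring
  rw [Finset.sum_congr rfl fun k _ => hsplit k, Finset.sum_add_distrib, Finset.sum_ite_eq']
  rcases l with ⟨_ | l, hl⟩
  · simp [jordanCoeffPair]
    ring
  · rw [Finset.sum_eq_single (⟨l, by omega⟩ : Fin m)]
    · simp [jordanCoeffPair]
      ring
    · intro b _ hb
      exact if_neg fun h => hb (Fin.ext (by simpa using h.symm))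
    · simp

theorem sum_sign_mul {m : ℕ} (i : Fin m) (a : Fin m → ℝ) :
    ∑ k, (if k < i then -1 else 1) * a k = 2 * ∑ k, (if k < i then 0 else a k) - ∑ k, a k := by
  rw [Finset.mul_sum, ← Finset.sum_sub_distrib]
  refine Finset.sum_congr rfl fun k _ => ?_
  split_ifs <;> ring

theorem sum_offDiag_mul {m : ℕ} (i : Fin m) (a : Fin m → ℝ) :
    ∑ k, (if i = k then 0 else 1) * a k = ∑ k, a k - a i := by
  have h : ∀ k, (if i = k then 0 else 1) * a k = a k - if i = k then a k else 0 := by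
    intro k
    split_ifs <;> ring
  rw [Finset.sum_congr rfl fun k _ => h k, Finset.sum_sub_distrib]
  simp

theorem sum_offDiag_sign_mul {m : ℕ} (i : Fin m) (a : Fin m → ℝ) :
    ∑ k, (if i = k then 0 else if k < i then -1 else 1) * a k =
      2 * ∑ k, (if k < i then 0 else a k) - ∑ k, a k - a i := by
  have h : ∀ k, (if i = k then 0 else if k < i then -1 else 1) * a k =
      (if k < i then -1 else 1) * a k - if i = k then a k else 0 := by
    intro k
    rcases eq_or_ne i k with rfl | h
    · simp
    · simp [h]
  rw [Finset.sum_congr rfl fun k _ => h k, Finset.sum_sub_distrib, sum_sign_mul]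
  simp

theorem sortedGam_mul_sortedBasis (m : ℕ) :
    sortedGam m * sortedBasis m = sortedBasis m * sortedLambda m := by
  ext i j
  rw [Matrix.mul_apply, Matrix.mul_apply]
  simp only [Fintype.sum_sum_type, Finset.univ_unique, Finset.sum_singleton]
  rcases i with i | i | i <;> rcases j with j | j | j <;>
    simp only [sortedGam, sortedBasis, sortedLambda, sum_offDiag_mul, sum_sign_mul,
      sum_offDiag_sign_mul, sum_ite_jordanCoeff_pred, sum_tail_jordanCoeff, mul_zero, zero_mul,
      Finset.sum_const_zero, one_mul, neg_one_mul, Finset.sum_neg_distrib] <;>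
    first
      | linarith [two_mul_sum_tail_neg_one_pow i]
      | (simp; try ring)

theorem isUnit_jordanCoeff (m : ℕ) :
    IsUnit (Matrix.of fun k l : Fin m => jordanCoeff l k) := by
  rw [Matrix.isUnit_iff_isUnit_det, Matrix.det_of_isUpperTriangular]
  · simp [jordanCoeff_self]
  · intro i j h
    exact jordanCoeff_eq_zero h

theorem isUnit_sortedBasis (m : ℕ) : IsUnit (sortedBasis m) := by
  rw [← Matrix.mulVec_injective_iff_isUnit, ← Matrix.coe_mulVecLin, ← LinearMap.ker_eq_bot,
    LinearMap.ker_eq_bot']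
  intro x hx
  have hrow : ∀ i, ∑ j, sortedBasis m i j * x j = 0 := fun i => congrFun hx i
  simp only [Fintype.sum_sum_type, Finset.univ_unique, Finset.sum_singleton] at hrow
  have hodd : ∀ i, x (.inl i) = 0 := by
    intro i
    have h₁ := hrow (.inl i)
    have h₂ := hrow (.inr (.inl i))
    simp only [sortedBasis, ite_mul, one_mul, zero_mul, Finset.sum_ite_eq, Finset.mem_univ,
      if_true, Finset.sum_const_zero] at h₁ h₂
    linarith
  have hlast : x (.inr (.inr ())) = 0 := by
    simpa [sortedBasis, hodd] using hrow (.inr (.inr ()))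
  have heven : (fun i => x (.inr (.inl i))) = 0 := by
    refine Matrix.mulVec_injective_iff_isUnit.2 (isUnit_jordanCoeff m) ?_
    ext i
    simpa [sortedBasis, hodd, hlast, Matrix.mulVec, dotProduct] using hrow (.inr (.inl i))
  ext (i | i | i)
  · exact hodd i
  · exact congrFun heven i
  · exact hlast

/-- Position of a sorted index among the rows and columns of `Γ`. -/
def gamPos (m : ℕ) : Idx m → Fin (2 * m + 1)
  | .inl i => ⟨2 * i + 1, by omega⟩
  | .inr (.inl i) => ⟨2 * i, by omega⟩
  | .inr (.inr _) => ⟨2 * m, by omega⟩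

/-- Position of a sorted index among the rows and columns of `diag(Λ, 0)`. -/
def lambdaPos (m : ℕ) : Idx m → Fin (2 * m + 1)
  | .inl i => ⟨i, by omega⟩
  | .inr (.inl i) => ⟨m + i, by omega⟩
  | .inr (.inr _) => ⟨2 * m, by omega⟩

theorem card_idx (m : ℕ) : Fintype.card (Idx m) = Fintype.card (Fin (2 * m + 1)) := by
  simp
  omega

theorem gamPos_bijective (m : ℕ) : Function.Bijective (gamPos m) := by
  refine (Fintype.bijective_iff_injective_and_card _).2 ⟨?_, card_idx m⟩
  rintro (i | i | i) (j | j | j) h <;> simp [gamPos, Fin.ext_iff] at h ⊢ <;> omega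

theorem lambdaPos_bijective (m : ℕ) : Function.Bijective (lambdaPos m) := by
  refine (Fintype.bijective_iff_injective_and_card _).2 ⟨?_, card_idx m⟩
  rintro (i | i | i) (j | j | j) h <;> simp [lambdaPos, Fin.ext_iff] at h ⊢ <;> omega

theorem Gam_submatrix (m : ℕ) :
    (Gam (2 * m + 1)).submatrix (gamPos m) (gamPos m) = sortedGam m := by
  ext (i | i | i) (j | j | j) <;>
    simp only [Matrix.submatrix_apply, Gam, gamPos, sortedGam, Matrix.of_apply, Fin.ext_iff,
      Fin.lt_def] <;>
    split_ifs <;> first | rfl | omega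

theorem LambdaOdd_submatrix (m : ℕ) :
    (LambdaOdd (2 * m + 1)).submatrix (lambdaPos m) (lambdaPos m) = sortedLambda m := by
  ext (i | i | i) (j | j | j) <;>
    simp only [Matrix.submatrix_apply, LambdaOdd, LambdaMat, lambdaPos, sortedLambda,
      Matrix.of_apply, Fin.ext_iff] <;>
    split_ifs <;> first | rfl | omega

/-- For odd `N ≥ 3`, `Γ` is similar to `diag(Λ_{N−1}, 0)`. -/
theorem gamma_similar_lambda_odd (N : ℕ) (hN : 3 ≤ N) (hNo : Odd N) :
    ∃ T : Matrix (Fin N) (Fin N) ℝ, IsUnit T.det ∧ T⁻¹ * Gam N * T = LambdaOdd N := by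
  obtain ⟨m, rfl⟩ := hNo
  let e := Equiv.ofBijective _ (gamPos_bijective m)
  let f := Equiv.ofBijective _ (lambdaPos_bijective m)
  let T := (sortedBasis m).submatrix e.symm f.symm
  have hT : IsUnit T.det := by
    rw [← Matrix.isUnit_iff_isUnit_det]
    exact (Matrix.isUnit_submatrix_equiv _ _).2 (isUnit_sortedBasis m)
  have hG : Gam (2 * m + 1) = (sortedGam m).submatrix e.symm e.symm := by
    rw [← Gam_submatrix]
    ext i j
    exact congrArg₂ _ (e.apply_symm_apply i).symm (e.apply_symm_apply j).symm
  have hL : LambdaOdd (2 * m + 1) = (sortedLambda m).submatrix f.symm f.symm := by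
    rw [← LambdaOdd_submatrix]
    ext i j
    exact congrArg₂ _ (f.apply_symm_apply i).symm (f.apply_symm_apply j).symm
  have hcomm : Gam (2 * m + 1) * T = T * LambdaOdd (2 * m + 1) := by
    rw [hG, hL, Matrix.submatrix_mul_equiv, Matrix.submatrix_mul_equiv,
      sortedGam_mul_sortedBasis]
  refine ⟨T, hT, ?_⟩
  rw [Matrix.mul_assoc, hcomm, ← Matrix.mul_assoc, Matrix.nonsing_inv_mul T hT, Matrix.one_mul]
end

section
/- Let N ≥ 2 be even, and let A1 and A12 be real n×n matrices. Then the matrix A = I_N ⊗ A1 + Γ ⊗ A12 is Hurwitz if and only if both A1 − A12 and A1 + A12 are Hurwitz. -/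
open Matrix Kronecker

/-- A real square matrix is Hurwitz (stable) if every eigenvalue over `ℂ` has negative
real part. -/
def IsHurwitz {ι : Type*} [Fintype ι] [DecidableEq ι] (M : Matrix ι ι ℝ) : Prop :=
  ∀ μ ∈ spectrum ℂ (M.map Complex.ofReal), μ.re < 0

/-- A scalar lies in the spectrum of a matrix over a field iff it has an eigenvector. -/
theorem Matrix.mem_spectrum_iff_exists_mulVec_eq_smul {K ι : Type*} [Field K] [Fintype ι]
    [DecidableEq ι] (M : Matrix ι ι K) (μ : K) :
    μ ∈ spectrum K M ↔ ∃ v, v ≠ 0 ∧ M *ᵥ v = μ • v := by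
  rw [spectrum.mem_iff, Matrix.isUnit_iff_isUnit_det, isUnit_iff_ne_zero, not_not,
    ← Matrix.exists_mulVec_eq_zero_iff]
  simp only [Matrix.sub_mulVec, Algebra.algebraMap_eq_smul_one, Matrix.smul_mulVec,
    Matrix.one_mulVec, sub_eq_zero, eq_comm]

/-- A scalar lies in the spectrum of a matrix over a field iff it has a left eigenvector. -/
theorem Matrix.mem_spectrum_iff_exists_vecMul_eq_smul {K ι : Type*} [Field K] [Fintype ι]
    [DecidableEq ι] (M : Matrix ι ι K) (μ : K) :
    μ ∈ spectrum K M ↔ ∃ v, v ≠ 0 ∧ v ᵥ* M = μ • v := by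
  rw [spectrum.mem_iff, Matrix.isUnit_iff_isUnit_det, isUnit_iff_ne_zero, not_not,
    ← Matrix.exists_vecMul_eq_zero_iff]
  simp only [Matrix.vecMul_sub, Algebra.algebraMap_eq_smul_one, Matrix.vecMul_smul,
    Matrix.vecMul_one, sub_eq_zero, eq_comm]

section Kronecker

variable {K ι κ : Type*} [Field K] [Fintype ι] [DecidableEq ι] [Fintype κ]

/-- Action of `1 ⊗ B + G ⊗ C`, one block at a time. -/
theorem one_kronecker_add_kronecker_mulVec (G : Matrix ι ι K) (B C : Matrix κ κ K)
    (x : ι × κ → K) (i : ι) :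
    (fun k => (((1 : Matrix ι ι K) ⊗ₖ B + G ⊗ₖ C) *ᵥ x) (i, k)) =
      B *ᵥ (fun l => x (i, l)) + C *ᵥ ∑ j, G i j • fun l => x (j, l) := by
  ext k
  rw [Matrix.add_mulVec]
  simp only [Pi.add_apply, Matrix.mulVec, dotProduct,
    Fintype.sum_prod_type, Matrix.kroneckerMap_apply, Matrix.one_apply, Finset.sum_apply,
    Pi.smul_apply, smul_eq_mul, Finset.mul_sum]
  congr 1
  · rw [Finset.sum_eq_single i (by intro j _ hj; simp [hj.symm]) (by simp)]
    simp
  · rw [Finset.sum_comm]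
    exact Finset.sum_congr rfl fun _ _ => Finset.sum_congr rfl fun _ _ => by ring

variable [DecidableEq κ]

/-- An eigenvector of `G` for `t` lifts the spectrum of `B + t C` into that of
`1 ⊗ B + G ⊗ C`. -/
theorem mem_spectrum_kronecker_of_mulVec {G : Matrix ι ι K} {B C : Matrix κ κ K} {t μ : K}
    {c : ι → K} (hc : c ≠ 0) (hG : G *ᵥ c = t • c) (hμ : μ ∈ spectrum K (B + t • C)) :
    μ ∈ spectrum K ((1 : Matrix ι ι K) ⊗ₖ B + G ⊗ₖ C) := by
  obtain ⟨v, hv, hBC⟩ := (Matrix.mem_spectrum_iff_exists_mulVec_eq_smul _ _).1 hμ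
  refine (Matrix.mem_spectrum_iff_exists_mulVec_eq_smul _ _).2 ⟨fun p => c p.1 * v p.2, ?_, ?_⟩
  · obtain ⟨i, hi⟩ := Function.ne_iff.1 hc
    obtain ⟨k, hk⟩ := Function.ne_iff.1 hv
    exact Function.ne_iff.2 ⟨(i, k), mul_ne_zero hi hk⟩
  · ext ⟨i, k⟩
    refine (congrFun (one_kronecker_add_kronecker_mulVec G B C _ i) k).trans ?_
    have hsum : (∑ j, G i j • fun l => c j * v l) = (t * c i) • v := by
      ext l
      have := congrFun hG i
      simp only [Matrix.mulVec, dotProduct, Pi.smul_apply, smul_eq_mul] at this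
      simp [Finset.sum_apply, ← this, Finset.sum_mul, mul_assoc]
    have hrow : (fun l => c i * v l) = c i • v := rfl
    have hk := congrFun hBC k
    simp only [hsum, hrow, Matrix.mulVec_smul, Matrix.add_mulVec, Matrix.smul_mulVec,
      Pi.add_apply, Pi.smul_apply, smul_eq_mul] at hk ⊢
    linear_combination c i * hk

/-- A matrix and its transpose have the same spectrum. -/
theorem Matrix.mem_spectrum_transpose {M : Matrix ι ι K} {μ : K} :
    μ ∈ spectrum K Mᵀ ↔ μ ∈ spectrum K M := by
  rw [Matrix.mem_spectrum_iff_exists_mulVec_eq_smul,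
    Matrix.mem_spectrum_iff_exists_vecMul_eq_smul]
  simp only [Matrix.mulVec_transpose]

/-- A left eigenvector of `G` for `t` lifts the spectrum of `B + t C` into that of
`1 ⊗ B + G ⊗ C`. -/
theorem mem_spectrum_kronecker_of_vecMul {G : Matrix ι ι K} {B C : Matrix κ κ K} {t μ : K}
    {c : ι → K} (hc : c ≠ 0) (hG : c ᵥ* G = t • c) (hμ : μ ∈ spectrum K (B + t • C)) :
    μ ∈ spectrum K ((1 : Matrix ι ι K) ⊗ₖ B + G ⊗ₖ C) := by
  rw [← Matrix.mem_spectrum_transpose] at hμ ⊢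
  rw [Matrix.transpose_add, Matrix.transpose_smul] at hμ
  have hT : ((1 : Matrix ι ι K) ⊗ₖ B + G ⊗ₖ C)ᵀ = (1 : Matrix ι ι K) ⊗ₖ Bᵀ + Gᵀ ⊗ₖ Cᵀ := by
    ext ⟨i, k⟩ ⟨j, l⟩
    simp [Matrix.one_apply, eq_comm]
  rw [hT]
  exact mem_spectrum_kronecker_of_mulVec hc (by rwa [Matrix.mulVec_transpose]) hμ

end Kronecker

/-- Summing over `2 m` consecutive indices pair by pair. -/
theorem Finset.sum_range_two_mul_eq_sum_pairs {M : Type*} [AddCommMonoid M] (f : ℕ → M) (m : ℕ) :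
    ∑ j ∈ Finset.range (2 * m), f j =
      ∑ q ∈ Finset.range m, (f (2 * q) + f (2 * q + 1)) := by
  induction m with
  | zero => simp
  | succ m ih =>
    rw [Nat.mul_succ, Finset.sum_range_succ, Finset.sum_range_succ, Finset.sum_range_succ, ih,
      add_assoc]

/-- The entries of `Γ`, on natural-number indices and with complex values. -/
def gamEntry (i j : ℕ) : ℂ :=
  if i = j then 0 else if j + 2 ≤ i ∧ j % 2 = 0 then -1 else 1

theorem Gam_map_apply {N : ℕ} (i j : Fin N) :
    (Gam N).map Complex.ofReal i j = gamEntry i j := by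
  simp only [Gam, gamEntry, Matrix.map_apply, Matrix.of_apply, Fin.ext_iff]
  split_ifs <;> simp

theorem gamEntry_even_sub_odd (p j : ℕ) :
    gamEntry (2 * p) j - gamEntry (2 * p + 1) j =
      if j = 2 * p then -1 else if j = 2 * p + 1 then 1 else 0 := by
  unfold gamEntry
  split_ifs <;> first | omega | norm_num

theorem gamEntry_add_of_lt {p q : ℕ} (h : q < p) :
    gamEntry (2 * p) (2 * q) + gamEntry (2 * p) (2 * q + 1) = 0 := by
  unfold gamEntry
  split_ifs <;> first | omega | norm_num

theorem gamEntry_zero_add_one (i : ℕ) :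
    gamEntry i 0 + gamEntry i 1 = if i < 2 then 1 else 0 := by
  unfold gamEntry
  split_ifs <;> first | omega | simp_all

/-- The only solution of the block eigenvalue equations is zero when `μ` is an eigenvalue of
neither `B - C` nor `B + C`. -/
theorem eq_zero_of_gam_block_equations {κ : Type*} [Fintype κ]
    {B C : Matrix κ κ ℂ} {μ : ℂ} {m : ℕ} {Y : ℕ → κ → ℂ}
    (hsub : ∀ v, (B - C) *ᵥ v = μ • v → v = 0) (hadd : ∀ v, (B + C) *ᵥ v = μ • v → v = 0)
    (hY : ∀ i < 2 * m,
      B *ᵥ Y i + C *ᵥ ∑ j ∈ Finset.range (2 * m), gamEntry i j • Y j = μ • Y i) :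
    ∀ i < 2 * m, Y i = 0 := by
  have hpair : ∀ p < m, Y (2 * p) = Y (2 * p + 1) := by
    intro p hp
    have hdiff : ∑ j ∈ Finset.range (2 * m), gamEntry (2 * p) j • Y j -
        ∑ j ∈ Finset.range (2 * m), gamEntry (2 * p + 1) j • Y j =
          -(Y (2 * p) - Y (2 * p + 1)) := by
      simp only [← Finset.sum_sub_distrib, ← sub_smul, gamEntry_even_sub_odd]
      rw [Finset.sum_range_two_mul_eq_sum_pairs,
        Finset.sum_eq_single_of_mem p (Finset.mem_range.2 hp)]
      · simp
        abel
      · intro q _ hq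
        rw [if_neg (by omega), if_neg (by omega), if_neg (by omega), if_neg (by omega)]
        simp
    refine sub_eq_zero.1 (hsub _ ?_)
    rw [smul_sub, ← hY (2 * p) (by omega), ← hY (2 * p + 1) (by omega), Matrix.sub_mulVec,
      sub_eq_add_neg, ← Matrix.mulVec_neg, ← hdiff, Matrix.mulVec_sub, Matrix.mulVec_sub]
    abel
  have heven : ∀ d p, p + d + 1 = m → Y (2 * p) = 0 := by
    intro d
    induction d using Nat.strong_induction_on with
    | _ d ih =>
      intro p hp
      refine hadd _ ?_
      rw [← hY (2 * p) (by omega), Matrix.add_mulVec]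
      congr 2
      rw [Finset.sum_range_two_mul_eq_sum_pairs,
        Finset.sum_eq_single_of_mem p (Finset.mem_range.2 (by omega)),
        ← hpair p (by omega), ← add_smul]
      · simp [gamEntry]
      · intro q hq hqp
        have hqm := Finset.mem_range.1 hq
        rw [← hpair q hqm, ← add_smul]
        rcases lt_or_gt_of_ne hqp with h | h
        · rw [gamEntry_add_of_lt h, zero_smul]
        · rw [ih (m - 1 - q) (by omega) q (by omega), smul_zero]
  intro i hi
  rcases Nat.even_or_odd' i with ⟨p, rfl | rfl⟩
  · exact heven (m - 1 - p) p (by omega)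
  · rw [← hpair p (by omega)]
    exact heven (m - 1 - p) p (by omega)

/-- For even `N ≥ 2`, the spectrum of `1 ⊗ B + Γ ⊗ C` is the union of those of `B ± C`. -/
theorem mem_spectrum_gam_kronecker_iff {κ : Type*} [Fintype κ] [DecidableEq κ] {N : ℕ}
    (hN : 2 ≤ N) (hNe : Even N) (B C : Matrix κ κ ℂ) (μ : ℂ) :
    μ ∈ spectrum ℂ ((1 : Matrix (Fin N) (Fin N) ℂ) ⊗ₖ B +
        (Gam N).map Complex.ofReal ⊗ₖ C) ↔
      μ ∈ spectrum ℂ (B - C) ∨ μ ∈ spectrum ℂ (B + C) := by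
  constructor
  · intro hμ
    by_contra! hnot
    obtain ⟨x, hx, hAx⟩ := (Matrix.mem_spectrum_iff_exists_mulVec_eq_smul _ _).1 hμ
    simp only [Matrix.mem_spectrum_iff_exists_mulVec_eq_smul, not_exists, not_and'] at hnot
    obtain ⟨m, rfl⟩ := hNe.two_dvd
    let Y : ℕ → κ → ℂ := fun i k => if h : i < 2 * m then x (⟨i, h⟩, k) else 0
    have hYx (i : Fin (2 * m)) : Y i = fun k => x (i, k) := by
      ext k
      simp [Y]
    have hY := eq_zero_of_gam_block_equations (Y := Y) (m := m)
      (fun v hv => not_not.1 (hnot.1 v hv)) (fun v hv => not_not.1 (hnot.2 v hv)) (by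
        intro i hi
        have h := one_kronecker_add_kronecker_mulVec ((Gam (2 * m)).map Complex.ofReal) B C x
          ⟨i, hi⟩
        simp only [Gam_map_apply, hAx, ← hYx] at h
        rw [← Fin.sum_univ_eq_sum_range fun j => gamEntry i j • Y j, ← h]
        ext k
        simp [Y, hi])
    refine hx (funext fun ⟨i, k⟩ => ?_)
    rw [← congrFun (hYx i) k, hY i i.2, Pi.zero_apply, Pi.zero_apply]
  · let i₀ : Fin N := ⟨0, by omega⟩
    let i₁ : Fin N := ⟨1, by omega⟩
    have hne : i₀ ≠ i₁ := by simp [i₀, i₁]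
    rintro (hμ | hμ)
    · refine mem_spectrum_kronecker_of_vecMul (c := Pi.single i₀ 1 - Pi.single i₁ 1) (t := -1)
        ?_ ?_ (by simpa [sub_eq_add_neg] using hμ)
      · exact Function.ne_iff.2 ⟨i₀, by simp [hne]⟩
      · ext j
        have h := gamEntry_even_sub_odd 0 j
        simp only [Matrix.sub_vecMul, Matrix.single_one_vecMul, Pi.sub_apply, Matrix.row,
          Gam_map_apply, Pi.smul_apply, Pi.single_apply, Fin.ext_iff, i₀, i₁] at h ⊢
        simp only [mul_zero, zero_add] at h
        rw [h]
        split_ifs <;> first | omega | simp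
    · refine mem_spectrum_kronecker_of_mulVec (c := Pi.single i₀ 1 + Pi.single i₁ 1) (t := 1)
        ?_ ?_ (by simpa using hμ)
      · exact Function.ne_iff.2 ⟨i₀, by simp [hne]⟩
      · ext i
        simp only [Matrix.mulVec_add, Matrix.mulVec_single_one, Pi.add_apply, Matrix.col_apply,
          Gam_map_apply, Pi.smul_apply, Pi.single_apply, Fin.ext_iff, i₀, i₁,
          gamEntry_zero_add_one]
        split_ifs <;> first | omega | simp

/-- For even `N ≥ 2`, `A = I_N ⊗ A1 + Γ ⊗ A12` is Hurwitz iff both `A1 − A12` and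
`A1 + A12` are Hurwitz. -/
theorem network_hurwitz_iff_even (N n : ℕ) (hN : 2 ≤ N) (hNe : Even N)
    (A1 A12 : Matrix (Fin n) (Fin n) ℝ) :
    IsHurwitz ((1 : Matrix (Fin N) (Fin N) ℝ) ⊗ₖ A1 + Gam N ⊗ₖ A12) ↔
      IsHurwitz (A1 - A12) ∧ IsHurwitz (A1 + A12) := by
  have hmap : ((1 : Matrix (Fin N) (Fin N) ℝ) ⊗ₖ A1 + Gam N ⊗ₖ A12).map Complex.ofReal =
      (1 : Matrix (Fin N) (Fin N) ℂ) ⊗ₖ A1.map Complex.ofReal +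
        (Gam N).map Complex.ofReal ⊗ₖ A12.map Complex.ofReal := by
    ext ⟨i, k⟩ ⟨j, l⟩
    simp [Matrix.one_apply, apply_ite Complex.ofReal]
  have hsub : (A1 - A12).map Complex.ofReal =
      A1.map Complex.ofReal - A12.map Complex.ofReal := by
    ext
    simp
  have hadd : (A1 + A12).map Complex.ofReal =
      A1.map Complex.ofReal + A12.map Complex.ofReal := by
    ext
    simp
  simp only [IsHurwitz, hmap, hsub, hadd, mem_spectrum_gam_kronecker_iff hN hNe, or_imp,
    forall_and]
end

section
/- Let N ≥ 3 be odd, and let A1 and A12 be real n×n matrices. Then the matrix A = I_N ⊗ A1 + Γ ⊗ A12 is Hurwitz if and only if A1, A1 − A12 and A1 + A12 are all Hurwitz. -/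
open Matrix Kronecker

theorem Matrix.mem_spectrum_iff_exists_mulVec {ι : Type*} [Fintype ι] [DecidableEq ι]
    (M : Matrix ι ι ℂ) (μ : ℂ) :
    μ ∈ spectrum ℂ M ↔ ∃ v : ι → ℂ, v ≠ 0 ∧ M *ᵥ v = μ • v := by
  rw [← Matrix.spectrum_toLin', ← Module.End.hasEigenvalue_iff_mem_spectrum]
  constructor
  · intro h
    obtain ⟨v, hv⟩ := h.exists_hasEigenvector
    exact ⟨v, hv.2, by simpa using hv.apply_eq_smul⟩
  · rintro ⟨v, hv, h⟩
    exact Module.End.hasEigenvalue_of_hasEigenvector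
      (Module.End.hasEigenvector_iff.mpr
        ⟨Module.End.mem_eigenspace_iff.mpr (by simpa using h), hv⟩)

/-- The eigenvalue equation for `I ⊗ A + G ⊗ B`, written blockwise. -/
theorem mem_spectrum_kronecker_iff {ι κ : Type*} [Fintype ι] [DecidableEq ι] [Fintype κ]
    [DecidableEq κ] (G : Matrix ι ι ℝ) (A B : Matrix κ κ ℝ) (μ : ℂ) :
    μ ∈ spectrum ℂ (((1 : Matrix ι ι ℝ) ⊗ₖ A + G ⊗ₖ B).map Complex.ofReal) ↔
      ∃ x : ι → κ → ℂ, x ≠ 0 ∧ ∀ i, A.map Complex.ofReal *ᵥ x i +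
        B.map Complex.ofReal *ᵥ (∑ j, G i j • x j) = μ • x i := by
  have key : ∀ (X : ι × κ → ℂ) (i : ι) (a : κ),
      ((((1 : Matrix ι ι ℝ) ⊗ₖ A + G ⊗ₖ B).map Complex.ofReal) *ᵥ X) (i, a) =
        (A.map Complex.ofReal *ᵥ (fun b => X (i, b)) +
        B.map Complex.ofReal *ᵥ (∑ j, G i j • fun b => X (j, b))) a := by
    intro X i a
    simp only [Matrix.mulVec_sum, Matrix.mulVec_smul, Pi.add_apply, Finset.sum_apply,
      Pi.smul_apply, Matrix.mulVec, dotProduct, Fintype.sum_prod_type, Matrix.map_apply,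
      Matrix.add_apply, Matrix.kroneckerMap_apply, Matrix.one_apply, Complex.ofReal_add,
      Complex.ofReal_mul, add_mul, Finset.sum_add_distrib, Complex.real_smul, Finset.mul_sum]
    congr 1
    · rw [Finset.sum_eq_single i]
      · simp
      · intro j _ hj
        simp [Ne.symm hj]
      · simp
    · simp only [mul_assoc]
  rw [Matrix.mem_spectrum_iff_exists_mulVec]
  constructor
  · rintro ⟨X, hX, h⟩
    refine ⟨fun i a => X (i, a), fun h0 => hX ?_, fun i => ?_⟩
    · ext ⟨i, a⟩
      exact congrFun (congrFun h0 i) a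
    · ext a
      rw [← key, h]
      rfl
  · rintro ⟨x, hx, h⟩
    refine ⟨fun p => x p.1 p.2, fun h0 => hx ?_, ?_⟩
    · ext i a
      exact congrFun h0 (i, a)
    · ext ⟨i, a⟩
      rw [key, h]
      rfl

section GamRows

variable {V : Type*} [AddCommGroup V] [Module ℝ V]

theorem Gam_row_sub_even {N : ℕ} (x : Fin N → V) (k l : Fin N) (hl : l.1 = k.1 + 1)
    (hk : k.1 % 2 = 0) :
    ∑ j, Gam N k j • x j - ∑ j, Gam N l j • x j = x l - x k := by
  have h : ∀ j, Gam N k j - Gam N l j = (if j = l then 1 else 0) - (if j = k then 1 else 0) := by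
    intro j
    simp only [Gam, Matrix.of_apply, Fin.ext_iff]
    split_ifs <;> first | omega | norm_num
  rw [← Finset.sum_sub_distrib]
  simp_rw [← sub_smul, h]
  simp [sub_smul, Finset.sum_sub_distrib]

theorem Gam_row_sub_odd {N : ℕ} (x : Fin N → V) (i k l : Fin N) (hi : k.1 = i.1 + 1)
    (hl : l.1 = k.1 + 1) (hk : k.1 % 2 = 1) :
    ∑ j, Gam N k j • x j - ∑ j, Gam N l j • x j = (2 : ℝ) • x i - x k + x l := by
  have h : ∀ j, Gam N k j - Gam N l j =
      (if j = i then 2 else 0) - (if j = k then 1 else 0) + (if j = l then 1 else 0) := by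
    intro j
    simp only [Gam, Matrix.of_apply, Fin.ext_iff]
    split_ifs <;> first | omega | norm_num
  rw [← Finset.sum_sub_distrib]
  simp_rw [← sub_smul, h]
  simp [sub_smul, add_smul, Finset.sum_sub_distrib, Finset.sum_add_distrib]

theorem Gam_last_row_eq_zero {N m : ℕ} (hm : N = 2 * m + 1) (x : Fin N → V)
    (hx : ∀ k l : Fin N, l.1 = k.1 + 1 → k.1 % 2 = 0 → x k = x l) (i : Fin N)
    (hi : i.1 = 2 * m) : ∑ j, Gam N i j • x j = 0 := by
  let f : ℕ → V := fun j => if h : j < N then x ⟨j, h⟩ else 0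
  let g : ℕ → ℝ := fun j => if j = 2 * m then 0 else if j % 2 = 0 then -1 else 1
  have hfg : ∀ j : Fin N, Gam N i j • x j = g j • f j := by
    intro j
    have hg : Gam N i j = g j := by
      have := j.2
      simp only [Gam, Matrix.of_apply, Fin.ext_iff, g]
      split_ifs <;> first | omega | rfl
    simp [hg, f]
  have hpair : ∀ t ≤ m, ∑ j ∈ Finset.range (2 * t), g j • f j = 0 := by
    intro t
    induction t with
    | zero => simp
    | succ t ih =>
      intro ht
      have hf : f (2 * t) = f (2 * t + 1) := by
        simp only [f]
        rw [dif_pos (by omega), dif_pos (by omega)]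
        exact hx _ _ rfl (by simp)
      have hg0 : g (2 * t) = -1 := by
        simp only [g]
        rw [if_neg (by omega), if_pos (by omega)]
      have hg1 : g (2 * t + 1) = 1 := by
        simp only [g]
        rw [if_neg (by omega), if_neg (by omega)]
      rw [show 2 * (t + 1) = 2 * t + 1 + 1 by ring, Finset.sum_range_succ,
        Finset.sum_range_succ, ih (by omega), hg0, hg1, hf]
      simp
  simp_rw [hfg]
  rw [Fin.sum_univ_eq_sum_range (fun j => g j • f j), hm, Finset.sum_range_succ,
    hpair m le_rfl]
  simp [g]

end GamRows

theorem Gam_mulVec_one_eigenvector {N : ℕ} (a b : Fin N) (ha : a.1 = 0) (hb : b.1 = 1) :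
    Gam N *ᵥ (Pi.single a 1 + Pi.single b 1) = (1 : ℝ) • (Pi.single a 1 + Pi.single b 1) := by
  ext i
  simp only [Matrix.mulVec_add, Matrix.mulVec_single_one, Pi.add_apply, Pi.smul_apply,
    Matrix.col_apply, Pi.single_apply, Gam, Matrix.of_apply, Fin.ext_iff]
  split_ifs <;> first | omega | norm_num

theorem Gam_mulVec_neg_one_eigenvector {N : ℕ} (a b : Fin N) (ha : a.1 = 1)
    (hb : b.1 + 1 = N) :
    Gam N *ᵥ (Pi.single a 1 - Pi.single b 1) = (-1 : ℝ) • (Pi.single a 1 - Pi.single b 1) := by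
  ext i
  have := i.2
  simp only [Matrix.mulVec_sub, Matrix.mulVec_single_one, Pi.sub_apply, Pi.smul_apply,
    Matrix.col_apply, Pi.single_apply, Gam, Matrix.of_apply, Fin.ext_iff]
  split_ifs <;> first | omega | norm_num

theorem Gam_mulVec_zero_eigenvector {N m : ℕ} (hm : N = 2 * m + 1) :
    Gam N *ᵥ (fun j => if j.1 % 4 < 2 then 1 else -1) = 0 := by
  set y : Fin N → ℝ := fun j => if j.1 % 4 < 2 then 1 else -1 with hy
  have hpair : ∀ k l : Fin N, l.1 = k.1 + 1 → k.1 % 2 = 0 → y k = y l := by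
    intro k l hl hk
    simp only [hy]
    split_ifs <;> first | omega | rfl
  have hdesc : ∀ t : ℕ, ∀ i : Fin N, i.1 + t = 2 * m → ∑ j, Gam N i j • y j = 0 := by
    intro t
    induction t with
    | zero => exact fun i hi => Gam_last_row_eq_zero hm y hpair i hi
    | succ t ih =>
      intro i hi
      let l : Fin N := ⟨i.1 + 1, by omega⟩
      have hl := ih l (by simp only [l]; omega)
      rcases Nat.mod_two_eq_zero_or_one i.1 with h | h
      · have := Gam_row_sub_even y i l rfl h
        rwa [hl, hpair i l rfl h, sub_self, sub_zero] at this
      · have := Gam_row_sub_odd y ⟨i.1 - 1, by omega⟩ i l (by simp only; omega) rfl h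
        rw [hl, hpair ⟨i.1 - 1, by omega⟩ i (by simp only; omega) (by simp only; omega),
          sub_zero] at this
        rw [this]
        simp only [hy, l, smul_eq_mul]
        split_ifs <;> first | omega | norm_num
  ext i
  exact hdesc (2 * m - i.1) i (by have := i.2; omega)

/-- An eigenvector of `G` for the eigenvalue `c` transports the spectrum of `A + c B` into that of
`I ⊗ A + G ⊗ B`. -/
theorem IsHurwitz.of_kronecker {ι κ : Type*} [Fintype ι] [DecidableEq ι] [Fintype κ]
    [DecidableEq κ] {G : Matrix ι ι ℝ} {A B : Matrix κ κ ℝ}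
    (h : IsHurwitz ((1 : Matrix ι ι ℝ) ⊗ₖ A + G ⊗ₖ B)) {y : ι → ℝ} {c : ℝ} (hy : y ≠ 0)
    (hG : G *ᵥ y = c • y) : IsHurwitz (A + c • B) := by
  intro μ hμ
  obtain ⟨v, hv, hvμ⟩ := (Matrix.mem_spectrum_iff_exists_mulVec _ _).mp hμ
  refine h μ ((mem_spectrum_kronecker_iff _ _ _ _).mpr ⟨fun j => y j • v, ?_, fun i => ?_⟩)
  · obtain ⟨i, hi⟩ := Function.ne_iff.mp hy
    exact fun h0 => smul_ne_zero hi hv (congrFun h0 i)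
  · have hsum : ∑ j, G i j • y j • v = (y i * c) • v := by
      have := congrFun hG i
      simp only [Matrix.mulVec, dotProduct, Pi.smul_apply, smul_eq_mul] at this
      simp_rw [smul_smul]
      rw [← Finset.sum_smul, this, mul_comm]
    have hmap : (A + c • B).map Complex.ofReal =
        A.map Complex.ofReal + c • B.map Complex.ofReal := by
      ext a b
      simp
    rw [hmap, Matrix.add_mulVec, Matrix.smul_mulVec] at hvμ
    rw [hsum, Matrix.mulVec_smul, Matrix.mulVec_smul, mul_smul, ← smul_add, hvμ, smul_comm]

theorem IsHurwitz.eq_zero_of_mulVec {κ : Type*} [Fintype κ] [DecidableEq κ]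
    {M : Matrix κ κ ℝ} (h : IsHurwitz M) {μ : ℂ} (hμ : 0 ≤ μ.re) {v : κ → ℂ}
    (hv : M.map Complex.ofReal *ᵥ v = μ • v) : v = 0 := by
  by_contra hne
  exact (h μ ((Matrix.mem_spectrum_iff_exists_mulVec _ _).mpr ⟨v, hne, hv⟩)).not_ge hμ

/-- For odd `N ≥ 3`, `A = I_N ⊗ A1 + Γ ⊗ A12` is Hurwitz iff `A1`, `A1 − A12` and
`A1 + A12` are all Hurwitz. -/
theorem network_hurwitz_iff_odd (N n : ℕ) (hN : 3 ≤ N) (hNo : Odd N)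
    (A1 A12 : Matrix (Fin n) (Fin n) ℝ) :
    IsHurwitz ((1 : Matrix (Fin N) (Fin N) ℝ) ⊗ₖ A1 + Gam N ⊗ₖ A12) ↔
      IsHurwitz A1 ∧ IsHurwitz (A1 - A12) ∧ IsHurwitz (A1 + A12) := by
  obtain ⟨m, hm⟩ := hNo
  constructor
  · intro h
    let z : Fin N := ⟨0, by omega⟩
    let o : Fin N := ⟨1, by omega⟩
    let e : Fin N := ⟨N - 1, by omega⟩
    have hzo : z ≠ o := by simp [z, o]
    have hoe : o ≠ e := by simp only [o, e, ne_eq, Fin.mk.injEq]; omega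
    refine ⟨?_, ?_, ?_⟩
    · simpa using h.of_kronecker (c := 0)
        (fun h0 => by simpa [z] using congrFun h0 z)
        ((Gam_mulVec_zero_eigenvector hm).trans (zero_smul ℝ _).symm)
    · have := h.of_kronecker (fun h0 => by simpa [hoe] using congrFun h0 o)
        (Gam_mulVec_neg_one_eigenvector o e rfl (by simp only [e]; omega))
      rwa [neg_one_smul, ← sub_eq_add_neg] at this
    · have := h.of_kronecker (fun h0 => by simpa [hzo] using congrFun h0 z)
        (Gam_mulVec_one_eigenvector z o rfl rfl)
      rwa [one_smul] at this
  · rintro ⟨h0, hneg, hpos⟩ μ hμ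
    obtain ⟨x, hx, hxμ⟩ := (mem_spectrum_kronecker_iff _ _ _ _).mp hμ
    by_contra! hre
    have hsub : ∀ k l : Fin N, A1.map Complex.ofReal *ᵥ (x k - x l) +
        A12.map Complex.ofReal *ᵥ (∑ j, Gam N k j • x j - ∑ j, Gam N l j • x j) =
        μ • (x k - x l) := by
      intro k l
      rw [Matrix.mulVec_sub, Matrix.mulVec_sub, smul_sub, ← hxμ k, ← hxμ l]
      abel
    have hpair : ∀ k l : Fin N, l.1 = k.1 + 1 → k.1 % 2 = 0 → x k = x l := by
      intro k l hl hk
      refine sub_eq_zero.mp (hneg.eq_zero_of_mulVec hre ?_)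
      rw [← hsub k l, Gam_row_sub_even x k l hl hk, Matrix.map_sub _ Complex.ofReal_sub,
        Matrix.sub_mulVec, ← neg_sub (x k) (x l), Matrix.mulVec_neg, sub_eq_add_neg]
    have hdesc : ∀ t : ℕ, ∀ i : Fin N, i.1 + t = 2 * m → x i = 0 := by
      intro t
      induction t with
      | zero =>
        intro i hi
        refine h0.eq_zero_of_mulVec hre ?_
        rw [← hxμ i, Gam_last_row_eq_zero hm x hpair i hi, Matrix.mulVec_zero, add_zero]
      | succ t ih =>
        intro i hi
        let l : Fin N := ⟨i.1 + 1, by omega⟩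
        have hl : x l = 0 := ih l (by simp only [l]; omega)
        rcases Nat.mod_two_eq_zero_or_one i.1 with h | h
        · rw [hpair i l rfl h, hl]
        · refine hpos.eq_zero_of_mulVec hre ?_
          have hrow := Gam_row_sub_odd x ⟨i.1 - 1, by omega⟩ i l (by simp only; omega) rfl h
          rw [hpair ⟨i.1 - 1, by omega⟩ i (by simp only; omega) (by simp only; omega), hl,
            add_zero, two_smul, add_sub_cancel_right] at hrow
          have := hsub i l
          rw [hrow, hl, sub_zero] at this
          rw [Matrix.map_add _ Complex.ofReal_add, Matrix.add_mulVec, this]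
    exact hx (funext fun i => hdesc (2 * m - i.1) i (by have := i.2; omega))
end

section
/- Let N ≥ 3 be odd, and let A1 and A12 be real n×n matrices. Then I_N ⊗ A1 + Γ_D ⊗ A12 is Hurwitz if and only if the matrices A1, A1 − A12, A1 − 3·A12, …, A1 − (N−2)·A12 and A1 − N·A12 (i.e., A1 − m·A12 for m = 0, m = N, and every odd m with 1 ≤ m ≤ N−2) are all Hurwitz. -/
open Matrix Kronecker

/-- Off-diagonal entries of the diffusive coupling matrix `Γ_D` (1-indexed: `γ_{ij} = −1` if
`i > j`, `j ≤ i−2` and `j` is odd; `γ_{ij} = 1` for all other `i ≠ j`). Indices 0-based here. -/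
def GamDOff (N : ℕ) (i j : Fin N) : ℝ :=
  if j.1 + 2 ≤ i.1 ∧ j.1 % 2 = 0 then -1 else 1

/-- The diffusive coupling matrix `Γ_D`: off-diagonal entries as in `GamDOff`, and diagonal
entries `γ_{ii} = −∑_{j ≠ i} γ_{ij}`, so every row sums to zero. -/
def GamD (N : ℕ) : Matrix (Fin N) (Fin N) ℝ :=
  Matrix.of fun i j =>
    if i = j then -(∑ k ∈ Finset.univ \ {i}, GamDOff N i k) else GamDOff N i j

/-- A real matrix is Hurwitz iff all complex roots of its characteristic polynomial have negative
real part. -/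
theorem isHurwitz_iff_charpoly {ι : Type*} [Fintype ι] [DecidableEq ι] (M : Matrix ι ι ℝ) :
    IsHurwitz M ↔ ∀ μ : ℂ, (M.charpoly.map Complex.ofRealHom).IsRoot μ → μ.re < 0 := by
  rw [← Matrix.charpoly_map]
  exact forall_congr' fun μ => by
    rw [Matrix.mem_spectrum_iff_isRoot_charpoly]
    rfl

/-- Characteristic polynomial of `1 ⊗ A + L ⊗ B` for a lower triangular `L`. -/
theorem charpoly_one_kronecker_add_lowerTriangular_kronecker {R ι κ : Type*} [CommRing R]
    [Fintype ι] [LinearOrder ι] [Fintype κ] [DecidableEq κ] (L : Matrix ι ι R)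
    (hL : ∀ i j, i < j → L i j = 0) (A B : Matrix κ κ R) :
    ((1 : Matrix ι ι R) ⊗ₖ A + L ⊗ₖ B).charpoly = ∏ i, (A + L i i • B).charpoly := by
  have htri : ((1 : Matrix ι ι R) ⊗ₖ A + L ⊗ₖ B).BlockTriangular
      (fun p : ι × κ => OrderDual.toDual p.1) := by
    intro p q hpq
    have h : p.1 < q.1 := hpq
    simp [Matrix.kroneckerMap_apply, hL _ _ h, Matrix.one_apply_ne h.ne]
  rw [Matrix.charpoly, htri.charmatrix.det_fintype, ← Equiv.prod_comp OrderDual.toDual]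
  refine Finset.prod_congr rfl fun i _ => ?_
  let e : κ ≃ {p : ι × κ // OrderDual.toDual p.1 = OrderDual.toDual i} :=
    { toFun := fun k => ⟨(i, k), rfl⟩
      invFun := fun p => p.1.2
      left_inv := fun _ => rfl
      right_inv := by
        rintro ⟨⟨a, k⟩, h⟩
        obtain rfl : a = i := h
        rfl }
  rw [Matrix.charpoly, ← Matrix.det_submatrix_equiv_self e]
  congr 1
  ext1 k l
  by_cases hkl : k = l <;>
    simp [e, Matrix.toSquareBlock_def, Matrix.charmatrix_apply, Matrix.kroneckerMap_apply, hkl,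
      Matrix.diagonal_apply]

/-- Similarity of `C` and `L` carries over to `1 ⊗ A + C ⊗ B` and `1 ⊗ A + L ⊗ B`. -/
theorem charpoly_one_kronecker_add_kronecker_of_mul_eq_mul {R ι κ : Type*} [CommRing R]
    [Fintype ι] [DecidableEq ι] [Fintype κ] [DecidableEq κ] {C L T : Matrix ι ι R}
    (hT : IsUnit T.det) (h : T * C = L * T) (A B : Matrix κ κ R) :
    ((1 : Matrix ι ι R) ⊗ₖ A + C ⊗ₖ B).charpoly
      = ((1 : Matrix ι ι R) ⊗ₖ A + L ⊗ₖ B).charpoly := by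
  have hU : IsUnit (T ⊗ₖ (1 : Matrix κ κ R)) := by
    rw [Matrix.isUnit_iff_isUnit_det, Matrix.det_kronecker]
    simpa using hT.pow _
  obtain ⟨U, hU⟩ := hU
  have hconj : (1 : Matrix ι ι R) ⊗ₖ A + L ⊗ₖ B
      = U.val * ((1 : Matrix ι ι R) ⊗ₖ A + C ⊗ₖ B) * U.val⁻¹ := by
    rw [← Matrix.coe_units_inv, Units.eq_mul_inv_iff_mul_eq, hU, add_mul, mul_add]
    simp only [← Matrix.mul_kronecker_mul, h, one_mul, mul_one]
  rw [hconj, Matrix.charpoly_units_conj]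

theorem sum_range_ite_even_add_two_le (i M : ℕ) :
    ∑ k ∈ Finset.range M, (if k + 2 ≤ i ∧ k % 2 = 0 then (-1 : ℤ) else 1)
      = M - 2 * min (i / 2) ((M + 1) / 2) := by
  induction M with
  | zero => simp
  | succ M ih =>
    rw [Finset.sum_range_succ, ih]
    split_ifs with h <;> push_cast <;> omega

theorem sum_GamDOff (N : ℕ) (i : Fin N) :
    ∑ k, GamDOff N i k = N - 2 * ((i.1 / 2 : ℕ) : ℝ) := by
  have h := sum_range_ite_even_add_two_le i.1 N
  have hmin : min ((i.1 : ℤ) / 2) (((N : ℤ) + 1) / 2) = ((i.1 / 2 : ℕ) : ℤ) := by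
    have := i.2
    omega
  push_cast at h
  rw [hmin] at h
  have h' := congrArg (Int.cast : ℤ → ℝ) h
  push_cast at h'
  simp only [GamDOff]
  rw [Fin.sum_univ_eq_sum_range (fun k => if k + 2 ≤ i.1 ∧ k % 2 = 0 then (-1 : ℝ) else 1) N]
  exact h'

theorem GamD_apply (N : ℕ) (i j : Fin N) :
    GamD N i j = if i = j then 1 - N + 2 * ((i.1 / 2 : ℕ) : ℝ) else GamDOff N i j := by
  rw [GamD, Matrix.of_apply]
  congr 1
  have h := Finset.sum_sdiff_eq_sub (f := GamDOff N i) (Finset.subset_univ {i})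
  rw [h, sum_GamDOff, Finset.sum_singleton]
  have hi : GamDOff N i i = 1 := by simp [GamDOff]
  rw [hi]
  ring

/-- The matrix taking differences of consecutive coordinates, keeping the last coordinate. -/
def consecutiveDiff (N : ℕ) : Matrix (Fin N) (Fin N) ℝ :=
  Matrix.of fun i j => (if j = i then 1 else 0) - (if j.1 = i.1 + 1 then 1 else 0)

theorem det_consecutiveDiff (N : ℕ) : (consecutiveDiff N).det = 1 := by
  rw [Matrix.det_of_isUpperTriangular]
  · simp [consecutiveDiff]
  · intro i j hij
    have h : j.1 < i.1 := hij
    have h₁ : j ≠ i := fun h' => by simp [h'] at h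
    have h₂ : j.1 ≠ i.1 + 1 := by omega
    simp [consecutiveDiff, h₁, h₂]

/-- The lower triangular form of `GamD N` in the coordinates given by `consecutiveDiff N`. -/
def GamDLower (N : ℕ) : Matrix (Fin N) (Fin N) ℝ :=
  Matrix.of fun i j =>
    if i.1 + 1 = N then (if j.1 % 2 = 0 ∧ j.1 + 1 < N then -1 else 0)
    else if i.1 % 2 = 0 then (if j = i then (i.1 : ℝ) - N else 0)
    else (if j = i then (i.1 : ℝ) + 1 - N else if j.1 + 1 = i.1 then 2 else 0)

theorem GamDLower_eq_zero_of_lt (N : ℕ) (i j : Fin N) (hij : i < j) : GamDLower N i j = 0 := by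
  have h : i.1 < j.1 := hij
  have := j.2
  have h₁ : j ≠ i := hij.ne'
  have h₂ : i.1 + 1 ≠ N := by omega
  have h₃ : j.1 + 1 ≠ i.1 := by omega
  simp [GamDLower, h₁, h₂, h₃]

theorem consecutiveDiff_mul_apply (N : ℕ) (M : Matrix (Fin N) (Fin N) ℝ) (i j : Fin N) :
    (consecutiveDiff N * M) i j
      = M i j - if h : i.1 + 1 < N then M ⟨i.1 + 1, h⟩ j else 0 := by
  simp only [Matrix.mul_apply, consecutiveDiff, Matrix.of_apply, sub_mul, ite_mul, one_mul,
    zero_mul, Finset.sum_sub_distrib, Finset.sum_ite_eq', Finset.mem_univ, if_true]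
  congr 1
  split_ifs with h
  · rw [Finset.sum_eq_single ⟨i.1 + 1, h⟩]
    · simp
    · intro b _ hb
      exact if_neg fun h' => hb (Fin.ext h')
    · simp
  · exact Finset.sum_eq_zero fun b _ => if_neg (by have := b.2; omega)

theorem mul_consecutiveDiff_apply (N : ℕ) (M : Matrix (Fin N) (Fin N) ℝ) (i j : Fin N) :
    (M * consecutiveDiff N) i j
      = M i j - if 0 < j.1 then M i ⟨j.1 - 1, by omega⟩ else 0 := by
  simp only [Matrix.mul_apply, consecutiveDiff, Matrix.of_apply, mul_sub, mul_ite, mul_one,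
    mul_zero, Finset.sum_sub_distrib, Finset.sum_ite_eq, Finset.mem_univ, if_true]
  congr 1
  split_ifs with h
  · rw [Finset.sum_eq_single ⟨j.1 - 1, by omega⟩]
    · exact if_pos (by simp only; omega)
    · intro b _ hb
      exact if_neg fun h' => hb (Fin.ext (by simp only; omega))
    · simp
  · exact Finset.sum_eq_zero fun b _ => if_neg (by omega)

theorem consecutiveDiff_mul_GamD (N : ℕ) (hNo : Odd N) :
    consecutiveDiff N * GamD N = GamDLower N * consecutiveDiff N := by
  ext i j
  rw [consecutiveDiff_mul_apply, mul_consecutiveDiff_apply]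
  obtain ⟨K, rfl⟩ := hNo
  obtain ⟨i, hi⟩ := i
  obtain ⟨j, hj⟩ := j
  simp only [GamD_apply, GamDLower, GamDOff, Matrix.of_apply, Fin.mk.injEq]
  obtain ⟨k, hk⟩ := Nat.even_or_odd' i
  obtain ⟨l, hl⟩ := Nat.even_or_odd' j
  have hkK : k = K ∨ k < K := by omega
  have hkl : l + 1 < k ∨ l + 1 = k ∨ l = k ∨ l = k + 1 ∨ k + 1 < l := by omega
  have hdiv : i / 2 = k := by omega
  have hdiv' : (i + 1) / 2 = if i = 2 * k then k else k + 1 := by split_ifs <;> omega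
  rw [hdiv, hdiv']
  rcases hk with rfl | rfl <;> rcases hl with rfl | rfl <;> rcases hkK with rfl | hkK <;>
    rcases hkl with hkl | rfl | rfl | rfl | hkl <;> try omega
  all_goals
    simp (disch := omega) only [if_pos, if_neg, dif_pos, dif_neg, ite_self]
    push_cast
    ring1

/-- For odd `N ≥ 3`, `I_N ⊗ A1 + Γ_D ⊗ A12` is Hurwitz iff `A1 − m·A12` is Hurwitz for
`m = 0`, `m = N`, and every odd `m` with `1 ≤ m ≤ N − 2`. -/
theorem diffusive_network_hurwitz_iff_odd (N n : ℕ) (hN : 3 ≤ N) (hNo : Odd N)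
    (A1 A12 : Matrix (Fin n) (Fin n) ℝ) :
    IsHurwitz ((1 : Matrix (Fin N) (Fin N) ℝ) ⊗ₖ A1 + GamD N ⊗ₖ A12) ↔
      (IsHurwitz A1 ∧ IsHurwitz (A1 - (N : ℝ) • A12) ∧
        ∀ m : ℕ, Odd m → 1 ≤ m → m ≤ N - 2 → IsHurwitz (A1 - (m : ℝ) • A12)) := by
  have key : IsHurwitz ((1 : Matrix (Fin N) (Fin N) ℝ) ⊗ₖ A1 + GamD N ⊗ₖ A12) ↔
      ∀ i, IsHurwitz (A1 + GamDLower N i i • A12) := by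
    simp only [isHurwitz_iff_charpoly]
    rw [charpoly_one_kronecker_add_kronecker_of_mul_eq_mul (by simp [det_consecutiveDiff])
        (consecutiveDiff_mul_GamD N hNo),
      charpoly_one_kronecker_add_lowerTriangular_kronecker _ (GamDLower_eq_zero_of_lt N)]
    simp only [Polynomial.map_prod, Polynomial.isRoot_prod, Finset.mem_univ, true_and]
    exact ⟨fun h i μ hμ => h μ ⟨i, hμ⟩, fun h μ ⟨i, hμ⟩ => h i μ hμ⟩
  have hNmod : N % 2 = 1 := Nat.odd_iff.1 hNo
  have hlast (i : Fin N) (hi : i.1 + 1 = N) : GamDLower N i i = 0 := by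
    simp [GamDLower, hi]
  have heven (i : Fin N) (hi : i.1 + 1 ≠ N) (h : i.1 % 2 = 0) :
      GamDLower N i i = -((N - i.1 : ℕ) : ℝ) := by
    rw [Nat.cast_sub i.2.le]
    simp [GamDLower, hi, h]
  have hodd (i : Fin N) (h : i.1 % 2 = 1) :
      GamDLower N i i = -((N - 1 - i.1 : ℕ) : ℝ) := by
    have hi : i.1 + 1 ≠ N := by omega
    rw [Nat.cast_sub (by omega), Nat.cast_sub (by omega)]
    simp [GamDLower, hi, h]
    ring
  rw [key]
  constructor
  · intro h
    refine ⟨?_, ?_, fun m hm h1 hm2 => ?_⟩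
    · simpa [hlast ⟨N - 1, by omega⟩ (by simp only; omega)] using h ⟨N - 1, by omega⟩
    · have := h ⟨0, by omega⟩
      rw [heven _ (by simp only; omega) rfl] at this
      simpa [sub_eq_add_neg] using this
    · have hm' := Nat.odd_iff.1 hm
      have := h ⟨N - 1 - m, by omega⟩
      rw [hodd _ (by simp only; omega)] at this
      have hsub : N - 1 - (N - 1 - m) = m := by omega
      simpa [sub_eq_add_neg, hsub] using this
  · rintro ⟨h0, hNN, hm⟩ i
    have hiN := i.2
    by_cases hi : i.1 + 1 = N
    · simpa [hlast i hi] using h0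
    rcases Nat.mod_two_eq_zero_or_one i.1 with h | h
    · rw [heven i hi h, neg_smul, ← sub_eq_add_neg]
      by_cases hi0 : i.1 = 0
      · simpa [hi0] using hNN
      · exact hm _ (Nat.odd_iff.2 (by omega)) (by omega) (by omega)
    · rw [hodd i h, neg_smul, ← sub_eq_add_neg]
      exact hm _ (Nat.odd_iff.2 (by omega)) (by omega) (by omega)
end

section
/- Let A1 be a real n×n matrix, B1 a real n×m matrix, C1 a real l×n matrix, and set A12 = B1·C1. Let Γ be any real N×N matrix all of whose row sums are zero (Γ·E_N = 0), and let A = I_N ⊗ A1 + Γ ⊗ A12, B = E_N ⊗ B1, C = E_Nᵀ ⊗ C1. Assume A is Hurwitz (hence so is A1), and let Q be a real Nn×Nn matrix satisfying Q·A + Aᵀ·Q + Cᵀ·C = 0 and Q1 a real n×n matrix satisfying Q1·A1 + A1ᵀ·Q1 + C1ᵀ·C1 = 0. Then trace(Bᵀ·Q·B) = N² · trace(B1ᵀ·Q1·B1); i.e., the H₂ norm of the network equals N times the H₂ norm of the single node. -/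
open Matrix Kronecker

/-- If `F` has a left inverse and intertwines `A'` with a Hurwitz matrix `A`,
then `A'` is Hurwitz. -/
theorem IsHurwitz.of_mul_eq_mul {ι κ : Type*} [Fintype ι] [DecidableEq ι] [Fintype κ]
    [DecidableEq κ] {A : Matrix ι ι ℝ} {A' : Matrix κ κ ℝ} {F : Matrix ι κ ℝ}
    {G : Matrix κ ι ℝ} (hA : IsHurwitz A) (hGF : G * F = 1) (hAF : A * F = F * A') :
    IsHurwitz A' := by
  intro μ hμ
  apply hA
  have hGF' : G.map Complex.ofRealHom * F.map Complex.ofRealHom = 1 := by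
    rw [← Matrix.map_mul, hGF, Matrix.map_one _ (map_zero _) (map_one _)]
  have hAF' : A.map Complex.ofRealHom * F.map Complex.ofRealHom =
      F.map Complex.ofRealHom * A'.map Complex.ofRealHom := by
    rw [← Matrix.map_mul, hAF, Matrix.map_mul]
  change μ ∈ spectrum ℂ (A'.map Complex.ofRealHom) at hμ
  change μ ∈ spectrum ℂ (A.map Complex.ofRealHom)
  rw [← Matrix.spectrum_toLin', ← Module.End.hasEigenvalue_iff_mem_spectrum] at hμ ⊢
  obtain ⟨v, hv⟩ := hμ.exists_hasEigenvector
  have hv' := hv.apply_eq_smul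
  rw [Matrix.toLin'_apply] at hv'
  refine Module.End.hasEigenvalue_of_hasEigenvector
    (x := F.map Complex.ofRealHom *ᵥ v) ⟨?_, fun h => hv.2 ?_⟩
  · rw [Module.End.mem_eigenspace_iff, Matrix.toLin'_apply, Matrix.mulVec_mulVec, hAF',
      ← Matrix.mulVec_mulVec, hv', Matrix.mulVec_smul]
  · rw [← Matrix.one_mulVec v, ← hGF', ← Matrix.mulVec_mulVec, h, Matrix.mulVec_zero]

/-- The homogeneous Lyapunov equation of a Hurwitz matrix has only the zero solution. -/
theorem IsHurwitz.eq_zero_of_lyapunov {ι : Type*} [Fintype ι] [DecidableEq ι]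
    {A X : Matrix ι ι ℝ} (hA : IsHurwitz A) (hX : X * A + Aᵀ * X = 0) : X = 0 := by
  set a := A.map Complex.ofRealHom with ha
  set x := X.map Complex.ofRealHom with hx
  change ∀ μ ∈ spectrum ℂ a, μ.re < 0 at hA
  have hcomm : x * a = -aᵀ * x := by
    rw [hx, ha, ← Matrix.map_mul, eq_neg_of_add_eq_zero_left hX, ← Matrix.neg_mul,
      Matrix.map_mul]
    congr 1
    ext i j
    simp
  have hpoly (p : Polynomial ℂ) :
      x * Polynomial.aeval a p = Polynomial.aeval (-aᵀ) p * x := by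
    induction p using Polynomial.induction_on' with
    | add p q hp hq => rw [map_add, map_add, mul_add, add_mul, hp, hq]
    | monomial k c =>
      have hpow : x * a ^ k = (-aᵀ) ^ k * x :=
        (SemiconjBy.pow_right (show SemiconjBy x a (-aᵀ) from hcomm) k)
      simp only [Polynomial.aeval_monomial, ← Algebra.smul_def, mul_smul_comm, smul_mul_assoc,
        hpow]
  have hunit : IsUnit (Polynomial.aeval (-aᵀ) a.charpoly) := by
    by_contra h0
    rw [(IsAlgClosed.splits a.charpoly).eq_prod_roots, a.charpoly_monic.leadingCoeff, map_one,
      one_mul] at h0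
    obtain ⟨μ, hμ, hroot⟩ := spectrum.exists_mem_of_not_isUnit_aeval_prod h0
    have h1 := hA μ (Matrix.mem_spectrum_iff_isRoot_charpoly.2 hroot)
    rw [← spectrum.neg_eq, Set.mem_neg, Matrix.mem_spectrum_iff_isRoot_charpoly,
      Matrix.charpoly_transpose, ← Matrix.mem_spectrum_iff_isRoot_charpoly] at hμ
    have h2 := hA _ hμ
    rw [Complex.neg_re] at h2
    linarith
  have hx0 : x = 0 := by
    rw [← hunit.mul_right_eq_zero, ← hpoly, Matrix.aeval_self_charpoly, mul_zero]
  ext i j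
  simpa [hx] using congrFun (congrFun hx0 i) j

/-- For a coupling matrix `Γ` with all row sums zero, a Hurwitz network matrix
`A = I_N ⊗ A1 + Γ ⊗ (B1·C1)`, `B = E_N ⊗ B1`, `C = E_Nᵀ ⊗ C1`, and observability Gramians
`Q` (for the network) and `Q1` (for a single node), one has
`trace(Bᵀ·Q·B) = N² · trace(B1ᵀ·Q1·B1)`: the H₂ norm of the network is `N` times the
H₂ norm of the single node. (Note: `A12 = B1·C1` forces the input dimension `m` and output
dimension `l` to coincide; here both are `m`.) -/
theorem diffusive_network_H2_norm (n m N : ℕ)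
    (A1 : Matrix (Fin n) (Fin n) ℝ) (B1 : Matrix (Fin n) (Fin m) ℝ)
    (C1 : Matrix (Fin m) (Fin n) ℝ) (Γ : Matrix (Fin N) (Fin N) ℝ)
    (EN : Matrix (Fin N) (Fin 1) ℝ) (hEN : EN = Matrix.of fun _ _ => 1)
    (hrow : Γ * EN = 0)
    (A : Matrix (Fin N × Fin n) (Fin N × Fin n) ℝ)
    (hA : A = (1 : Matrix (Fin N) (Fin N) ℝ) ⊗ₖ A1 + Γ ⊗ₖ (B1 * C1))
    (B : Matrix (Fin N × Fin n) (Fin 1 × Fin m) ℝ) (hB : B = EN ⊗ₖ B1)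
    (C : Matrix (Fin 1 × Fin m) (Fin N × Fin n) ℝ) (hC : C = EN.transpose ⊗ₖ C1)
    (hHur : IsHurwitz A)
    (Q : Matrix (Fin N × Fin n) (Fin N × Fin n) ℝ)
    (hQ : Q * A + A.transpose * Q + C.transpose * C = 0)
    (Q1 : Matrix (Fin n) (Fin n) ℝ)
    (hQ1 : Q1 * A1 + A1.transpose * Q1 + C1.transpose * C1 = 0) :
    (B.transpose * Q * B).trace = (N : ℝ) ^ 2 * (B1.transpose * Q1 * B1).trace := by
  rcases Nat.eq_zero_or_pos N with rfl | hN
  · simp [Matrix.trace, Matrix.mul_apply]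
  have hN0 : (N : ℝ) ≠ 0 := by positivity
  have hEE : ENᵀ * EN = (N : ℝ) • (1 : Matrix (Fin 1) (Fin 1) ℝ) := by
    ext i j
    simp [hEN, Matrix.mul_apply, Subsingleton.elim i j]
  set F := EN ⊗ₖ (1 : Matrix (Fin n) (Fin n) ℝ) with hF
  set A' := (1 : Matrix (Fin 1) (Fin 1) ℝ) ⊗ₖ A1 with hA'
  set B' := (1 : Matrix (Fin 1) (Fin 1) ℝ) ⊗ₖ B1 with hB'
  set C' := (1 : Matrix (Fin 1) (Fin 1) ℝ) ⊗ₖ C1 with hC'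
  set Q' := (1 : Matrix (Fin 1) (Fin 1) ℝ) ⊗ₖ Q1 with hQ'
  have hFt : Fᵀ = ENᵀ ⊗ₖ (1 : Matrix (Fin n) (Fin n) ℝ) := by
    rw [hF, ← Matrix.kroneckerMap_transpose, Matrix.transpose_one]
  have hAF : A * F = F * A' := by
    rw [hA, hF, hA', Matrix.add_mul, ← Matrix.mul_kronecker_mul, ← Matrix.mul_kronecker_mul,
      ← Matrix.mul_kronecker_mul, hrow]
    simp
  have hAFt : Fᵀ * Aᵀ = A'ᵀ * Fᵀ := by
    rw [← Matrix.transpose_mul, hAF, Matrix.transpose_mul]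
  have hGF : ((N : ℝ)⁻¹ • Fᵀ) * F = 1 := by
    rw [hFt, hF, Matrix.smul_mul, ← Matrix.mul_kronecker_mul, hEE, Matrix.smul_kronecker,
      smul_smul, inv_mul_cancel₀ hN0]
    simp
  have hCF : C * F = (N : ℝ) • C' := by
    rw [hC, hF, ← Matrix.mul_kronecker_mul, hEE, Matrix.smul_kronecker, Matrix.mul_one]
  have hBF : B = F * B' := by
    rw [hB, hF, hB', ← Matrix.mul_kronecker_mul, Matrix.mul_one, Matrix.one_mul]
  have hnet : Fᵀ * Q * F * A' + A'ᵀ * (Fᵀ * Q * F) + (C * F)ᵀ * (C * F) = 0 := by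
    calc
      _ = Fᵀ * (Q * A + Aᵀ * Q + Cᵀ * C) * F := by
        simp only [Matrix.mul_add, Matrix.add_mul, Matrix.mul_assoc, Matrix.transpose_mul, hAF]
        simp only [← Matrix.mul_assoc, hAFt]
      _ = 0 := by rw [hQ, Matrix.mul_zero, Matrix.zero_mul]
  have hnode : Q' * A' + A'ᵀ * Q' + C'ᵀ * C' = 0 := by
    rw [hA', hQ', hC', ← Matrix.kroneckerMap_transpose, ← Matrix.kroneckerMap_transpose,
      Matrix.transpose_one, ← Matrix.mul_kronecker_mul, ← Matrix.mul_kronecker_mul,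
      ← Matrix.mul_kronecker_mul, Matrix.one_mul, ← Matrix.kronecker_add,
      ← Matrix.kronecker_add, hQ1, Matrix.kronecker_zero]
  have hgram : Fᵀ * Q * F = (N : ℝ) ^ 2 • Q' := by
    rw [← sub_eq_zero]
    refine (hHur.of_mul_eq_mul hGF hAF).eq_zero_of_lyapunov ?_
    calc
      _ = (Fᵀ * Q * F * A' + A'ᵀ * (Fᵀ * Q * F) + (C * F)ᵀ * (C * F)) -
          (N : ℝ) ^ 2 • (Q' * A' + A'ᵀ * Q' + C'ᵀ * C') := by
        rw [hCF, Matrix.transpose_smul, Matrix.smul_mul, Matrix.mul_smul, smul_smul, ← sq,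
          Matrix.sub_mul, Matrix.mul_sub, Matrix.smul_mul, Matrix.mul_smul, smul_add, smul_add]
        abel
      _ = 0 := by rw [hnet, hnode, smul_zero, sub_zero]
  calc
    (Bᵀ * Q * B).trace = (B'ᵀ * (Fᵀ * Q * F) * B').trace := by
      rw [hBF, Matrix.transpose_mul]
      simp only [Matrix.mul_assoc]
    _ = (N : ℝ) ^ 2 * (B1ᵀ * Q1 * B1).trace := by
      rw [hgram, hB', hQ', ← Matrix.kroneckerMap_transpose, Matrix.transpose_one, Matrix.mul_smul,
        Matrix.smul_mul, ← Matrix.mul_kronecker_mul, ← Matrix.mul_kronecker_mul,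
        Matrix.trace_smul, Matrix.trace_kronecker]
      simp
end

section
/- Let a, b, c be real numbers with a < 0, let N ≥ 1, and let Γ_A be the N×N antisymmetric coupling matrix. Set A = a·I_N + b·c·Γ_A, B = b·I_N, C = c·I_N, and Q = (−c²/(2a))·I_N. Then: (i) A is Hurwitz; (ii) Q satisfies the Lyapunov equation Q·A + Aᵀ·Q + Cᵀ·C = 0; and (iii) trace(Bᵀ·Q·B) = N·b²·c²/(−2a). Consequently, the H₂ norm of the network, √(trace(Bᵀ·Q·B)), equals √N · γ₂, where γ₂ = |b·c|/√(−2a) is the H₂ norm of the single first-order node ẋ = a·x + b·w, y = c·x. -/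
open Matrix

/-- The antisymmetric coupling matrix `Γ_A`: `γ_{ij} = 1` for `i < j`, `γ_{ij} = −1` for
`i > j`, `γ_{ii} = 0`. -/
def GamA (N : ℕ) : Matrix (Fin N) (Fin N) ℝ :=
  Matrix.of fun i j => if i < j then 1 else if j < i then -1 else 0

/-- If the symmetric part of a real matrix is `a • 1`, all its complex eigenvalues have real
part `a`. -/
theorem re_eq_of_mem_spectrum_of_add_transpose {ι : Type*} [Fintype ι] [DecidableEq ι]
    {M : Matrix ι ι ℝ} {a : ℝ} (hM : M + Mᵀ = (2 * a) • (1 : Matrix ι ι ℝ))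
    {μ : ℂ} (hμ : μ ∈ spectrum ℂ (M.map Complex.ofReal)) : μ.re = a := by
  rw [spectrum.mem_iff, Matrix.isUnit_iff_isUnit_det, isUnit_iff_ne_zero, not_not,
    ← Matrix.exists_mulVec_eq_zero_iff] at hμ
  obtain ⟨v, hv, hμv⟩ := hμ
  have heig : M.map Complex.ofReal *ᵥ v = μ • v := by
    rw [Matrix.sub_mulVec, Algebra.algebraMap_eq_smul_one, Matrix.smul_mulVec,
      Matrix.one_mulVec, sub_eq_zero] at hμv
    exact hμv.symm
  have hsum : M.map Complex.ofReal + (M.map Complex.ofReal)ᴴ =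
      (2 * a : ℂ) • (1 : Matrix ι ι ℂ) := by
    ext i j
    have h := congrFun (congrFun hM i) j
    simp only [Matrix.add_apply, Matrix.transpose_apply, Matrix.smul_apply, Matrix.one_apply,
      smul_eq_mul] at h
    simp only [Matrix.add_apply, Matrix.conjTranspose_apply, Matrix.map_apply,
      Matrix.smul_apply, Matrix.one_apply, smul_eq_mul, Complex.star_def, Complex.conj_ofReal]
    rw [← Complex.ofReal_add, h]
    split_ifs <;> simp
  have hadj : star v ⬝ᵥ ((M.map Complex.ofReal)ᴴ *ᵥ v) = star μ * (star v ⬝ᵥ v) := by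
    rw [Matrix.dotProduct_mulVec, ← Matrix.star_mulVec, heig, star_smul, smul_dotProduct,
      smul_eq_mul]
  have hquad : (μ + star μ) * (star v ⬝ᵥ v) = (2 * a : ℂ) * (star v ⬝ᵥ v) := by
    have h := congrArg (fun K => star v ⬝ᵥ (K *ᵥ v)) hsum
    simp only [Matrix.add_mulVec, dotProduct_add, hadj, heig, Matrix.smul_mulVec,
      Matrix.one_mulVec, dotProduct_smul, smul_eq_mul] at h
    rw [add_mul, h]
  have hne : star v ⬝ᵥ v ≠ 0 := by
    open scoped ComplexOrder in
    exact fun h => hv (dotProduct_star_self_eq_zero.mp h)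
  have hre := congrArg Complex.re (mul_right_cancel₀ hne hquad)
  simp at hre
  linarith

theorem GamA_transpose (N : ℕ) : (GamA N)ᵀ = -GamA N := by
  ext i j
  rcases lt_trichotomy i j with h | h | h <;> simp [GamA, h, h.not_gt]

/-- For a first-order node `ẋ = a·x + b·w`, `y = c·x` with `a < 0`, the antisymmetrically
coupled network `A = a·I_N + b·c·Γ_A`, `B = b·I_N`, `C = c·I_N` has Gramian
`Q = (−c²/(2a))·I_N`: (i) `A` is Hurwitz; (ii) `Q·A + Aᵀ·Q + Cᵀ·C = 0`;
(iii) `trace(Bᵀ·Q·B) = N·b²·c²/(−2a)`; hence the H₂ norm of the network is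
`√N · γ₂` where `γ₂ = |b·c|/√(−2a)` is the H₂ norm of a single node. -/
theorem antisymmetric_network_H2_norm (N : ℕ) (hN : 1 ≤ N) (a b c : ℝ) (ha : a < 0)
    (A : Matrix (Fin N) (Fin N) ℝ) (hA : A = a • (1 : Matrix (Fin N) (Fin N) ℝ) + (b * c) • GamA N)
    (B : Matrix (Fin N) (Fin N) ℝ) (hB : B = b • (1 : Matrix (Fin N) (Fin N) ℝ))
    (C : Matrix (Fin N) (Fin N) ℝ) (hC : C = c • (1 : Matrix (Fin N) (Fin N) ℝ))
    (Q : Matrix (Fin N) (Fin N) ℝ)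
    (hQ : Q = (-(c ^ 2) / (2 * a)) • (1 : Matrix (Fin N) (Fin N) ℝ)) :
    IsHurwitz A ∧
      Q * A + A.transpose * Q + C.transpose * C = 0 ∧
      (B.transpose * Q * B).trace = N * b ^ 2 * c ^ 2 / (-(2 * a)) ∧
      Real.sqrt (B.transpose * Q * B).trace =
        Real.sqrt N * (|b * c| / Real.sqrt (-(2 * a))) := by
  have ha0 : a ≠ 0 := ha.ne
  have hAt : Aᵀ = a • (1 : Matrix (Fin N) (Fin N) ℝ) - (b * c) • GamA N := by
    simp [hA, GamA_transpose, sub_eq_add_neg]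
  have htrace : (Bᵀ * Q * B).trace = N * b ^ 2 * c ^ 2 / (-(2 * a)) := by
    simp [hB, hQ, Matrix.trace_smul]
    field_simp
  refine ⟨fun μ hμ => ?_, ?_, htrace, ?_⟩
  · have hsum : A + Aᵀ = (2 * a) • (1 : Matrix (Fin N) (Fin N) ℝ) := by
      rw [hAt, hA]
      module
    rwa [re_eq_of_mem_spectrum_of_add_transpose hsum hμ]
  · rw [hAt, hA, hQ, hC]
    simp only [Matrix.transpose_smul, Matrix.transpose_one, Matrix.smul_mul, Matrix.mul_smul,
      Matrix.one_mul, Matrix.mul_one]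
    match_scalars <;> field_simp <;> ring
  · rw [htrace, mul_assoc, ← mul_pow, mul_div_assoc, Real.sqrt_mul N.cast_nonneg,
      Real.sqrt_div (sq_nonneg _), Real.sqrt_sq_eq_abs]
end
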